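/- arXiv:math/0603376 — 4 statements merged into one kernel-verified Lean document; each statement's English description precedes it below -/
import Mathlib

section
/- Let H be a bialgebra over a commutative ring R, and let A ⊆ H be an R-submodule with 1 ∈ A, A·A ⊆ A and Δ(A) ⊆ H ⊗ A (a subalgebra and left coideal). Then the submodule H·A⁺ (the left ideal generated by A⁺ := A ∩ ker ε) is a coideal: ε(H·A⁺) = 0 and Δ(H·A⁺) ⊆ (H·A⁺)⊗H + H⊗(H·A⁺). (This is the map 𝔸 → 𝕂, A ↦ H·A⁺, from subalgebras left coideals to coideals left ideals, underlying the correspondence between quantum homogeneous spaces and quantum subgroups.) -/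
open TensorProduct

/-- The `R`-submodule `H·M` of `H` spanned by all products `h * m` with `h ∈ H`, `m ∈ M`. -/
noncomputable def leftIdealSpan (R : Type*) {H : Type*} [CommRing R] [Ring H] [Algebra R H]
    (M : Submodule R H) : Submodule R H :=
  Submodule.span R {x : H | ∃ h : H, ∃ m ∈ M, x = h * m}

/-- The span `H·M` is stable under left multiplication. -/
theorem mul_mem_leftIdealSpan {R H : Type*} [CommRing R] [Ring H] [Algebra R H]
    {M : Submodule R H} (h : H) {x : H} (hx : x ∈ leftIdealSpan R M) :
    h * x ∈ leftIdealSpan R M := by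
  induction hx using Submodule.span_induction with
  | mem x hx =>
    obtain ⟨g, m, hm, rfl⟩ := hx
    exact Submodule.subset_span ⟨h * g, m, hm, (mul_assoc h g m).symm⟩
  | zero => simp
  | add x y _ _ hx hy => rw [mul_add]; exact add_mem hx hy
  | smul r x _ hx => rw [mul_smul_comm]; exact Submodule.smul_mem _ r hx

theorem mem_leftIdealSpan {R H : Type*} [CommRing R] [Ring H] [Algebra R H]
    {M : Submodule R H} {m : H} (hm : m ∈ M) : m ∈ leftIdealSpan R M :=
  Submodule.subset_span ⟨1, m, hm, (one_mul m).symm⟩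

/-- If `P` and `Q` are stable under left multiplication, then so is the image of `P ⊗ Q`. -/
theorem mul_mem_range_map {R S T P Q : Type*} [CommRing R] [Ring S] [Algebra R S] [Ring T]
    [Algebra R T] [AddCommGroup P] [Module R P] [AddCommGroup Q] [Module R Q]
    (f : P →ₗ[R] S) (g : Q →ₗ[R] T)
    (hf : ∀ s p, s * f p ∈ LinearMap.range f) (hg : ∀ t q, t * g q ∈ LinearMap.range g)
    (z : S ⊗[R] T) {w : S ⊗[R] T} (hw : w ∈ LinearMap.range (TensorProduct.map f g)) :
    z * w ∈ LinearMap.range (TensorProduct.map f g) := by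
  obtain ⟨w, rfl⟩ := hw
  induction w using TensorProduct.induction_on with
  | zero => simp
  | add x y hx hy => rw [map_add, mul_add]; exact add_mem hx hy
  | tmul p q =>
    induction z using TensorProduct.induction_on with
    | zero => simp
    | add x y hx hy => rw [add_mul]; exact add_mem hx hy
    | tmul s t =>
      obtain ⟨p', hp⟩ := hf s p
      obtain ⟨q', hq⟩ := hg t q
      exact ⟨p' ⊗ₜ q', by
        rw [TensorProduct.map_tmul, TensorProduct.map_tmul, Algebra.TensorProduct.tmul_mul_tmul,
          hp, hq]⟩

/-- An element of `H ⊗ A` agrees with its image under `id ⊗ ε` (tensored with `1`) modulo `H ⊗ J`, as soon as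
`J` contains `A ∩ ker ε`. -/
theorem sub_tmul_one_mem_range_map {R H : Type*} [CommRing R] [Ring H] [Bialgebra R H]
    {A J : Submodule R H} (h1 : (1 : H) ∈ A)
    (hJ : A ⊓ LinearMap.ker (Coalgebra.counit (R := R) (A := H)) ≤ J) {w : H ⊗[R] H}
    (hw : w ∈ LinearMap.range (TensorProduct.map (LinearMap.id (R := R) (M := H)) A.subtype)) :
    w - TensorProduct.rid R H (Coalgebra.counit.lTensor H w) ⊗ₜ[R] (1 : H) ∈
      LinearMap.range (TensorProduct.map (LinearMap.id (R := R) (M := H)) J.subtype) := by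
  obtain ⟨w, rfl⟩ := hw
  induction w using TensorProduct.induction_on with
  | zero => simp
  | add x y hx hy =>
    simp only [map_add, add_tmul]
    rw [add_sub_add_comm]
    exact add_mem hx hy
  | tmul h a =>
    have ha : (a : H) - Coalgebra.counit (R := R) (a : H) • (1 : H) ∈ J :=
      hJ ⟨sub_mem a.2 (A.smul_mem _ h1), by simp⟩
    exact ⟨h ⊗ₜ ⟨_, ha⟩, by simp [tmul_sub, smul_tmul]⟩

/-- Let `H` be a bialgebra over a commutative ring `R` and `A ⊆ H` a
submodule with `1 ∈ A`, `A·A ⊆ A` and `Δ(A) ⊆ H ⊗ A` (a subalgebra and left coideal).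
Then `H·A⁺` (where `A⁺ = A ∩ ker ε`) is a coideal: `ε(H·A⁺) = 0` and
`Δ(H·A⁺) ⊆ (H·A⁺)⊗H + H⊗(H·A⁺)`. -/
theorem stmt_5 {R H : Type*} [CommRing R] [Ring H] [Bialgebra R H]
    (A : Submodule R H) (h1 : (1 : H) ∈ A)
    (hmul : ∀ x ∈ A, ∀ y ∈ A, x * y ∈ A)
    (hco : ∀ a ∈ A, Coalgebra.comul (R := R) a ∈
      LinearMap.range (TensorProduct.map (LinearMap.id (R := R) (M := H)) A.subtype)) :
    (∀ x ∈ leftIdealSpan R (A ⊓ LinearMap.ker (Coalgebra.counit (R := R) (A := H))),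
        Coalgebra.counit (R := R) x = (0 : R)) ∧
    (∀ x ∈ leftIdealSpan R (A ⊓ LinearMap.ker (Coalgebra.counit (R := R) (A := H))),
        Coalgebra.comul (R := R) x ∈
          LinearMap.range (TensorProduct.map
            (leftIdealSpan R (A ⊓ LinearMap.ker (Coalgebra.counit (R := R) (A := H)))).subtype
            (LinearMap.id (R := R) (M := H))) ⊔
          LinearMap.range (TensorProduct.map (LinearMap.id (R := R) (M := H))
            (leftIdealSpan R
              (A ⊓ LinearMap.ker (Coalgebra.counit (R := R) (A := H)))).subtype)) := by
  set J := leftIdealSpan R (A ⊓ LinearMap.ker (Coalgebra.counit (R := R) (A := H)))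
  have hJmul (h : H) (j : J) : h * J.subtype j ∈ LinearMap.range J.subtype := by
    rw [Submodule.range_subtype]
    exact mul_mem_leftIdealSpan h j.2
  have hid (h k : H) : h * LinearMap.id (R := R) k ∈ LinearMap.range (LinearMap.id (R := R)) :=
    ⟨_, rfl⟩
  refine ⟨fun x hx => ?_, fun x hx => ?_⟩
  · induction hx using Submodule.span_induction with
    | mem x hx =>
      obtain ⟨h, m, hm, rfl⟩ := hx
      rw [Bialgebra.counit_mul, LinearMap.mem_ker.mp hm.2, mul_zero]
    | zero => simp
    | add x y _ _ hx hy => rw [map_add, hx, hy, add_zero]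
    | smul r x _ hx => rw [map_smul, hx, smul_zero]
  · induction hx using Submodule.span_induction with
    | mem x hx =>
      obtain ⟨h, m, hm, rfl⟩ := hx
      have hsub := sub_tmul_one_mem_range_map h1 (fun _ => mem_leftIdealSpan) (hco m hm.1)
      rw [Coalgebra.lTensor_counit_comul, TensorProduct.rid_tmul, one_smul] at hsub
      rw [Bialgebra.comul_mul, ← add_sub_cancel (m ⊗ₜ[R] (1 : H)) (Coalgebra.comul m), mul_add]
      exact Submodule.add_mem_sup
        (mul_mem_range_map _ _ hJmul hid _ ⟨(⟨m, mem_leftIdealSpan hm⟩ : J) ⊗ₜ 1, rfl⟩)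
        (mul_mem_range_map _ _ hid hJmul _ hsub)
    | zero => simp
    | add x y _ _ hx hy => rw [map_add]; exact add_mem hx hy
    | smul r x _ hx => rw [map_smul]; exact Submodule.smul_mem _ r hx
end

section
/- Let H be a bialgebra over a field k, and let K ⊆ H be a k-subspace with H·K ⊆ K, ε(K) = 0 and Δ(K) ⊆ K⊗H + H⊗K (a left ideal and coideal). Then the space of K-coinvariants H^{co K} := { y ∈ H | Δ(y) − y⊗1 ∈ H ⊗ K } is a unital subalgebra of H (1 ∈ H^{co K} and it is closed under multiplication) and a left coideal: Δ(H^{co K}) ⊆ H ⊗ H^{co K}. (This is the map 𝕂 → 𝔸, K ↦ H^{co K}, from coideals left ideals to subalgebras left coideals, underlying the correspondence between quantum subgroups and quantum homogeneous spaces.) -/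
open TensorProduct

/-- The `K`-coinvariants `H^{co K} = { y ∈ H | Δ(y) − y⊗1 ∈ H ⊗ K }`, as a submodule. -/
noncomputable def coinvariants {R H : Type*} [CommRing R] [Ring H] [Bialgebra R H]
    (K : Submodule R H) : Submodule R H :=
  Submodule.comap
    (Coalgebra.comul (R := R) (A := H) - (TensorProduct.mk R H H).flip 1)
    (LinearMap.range (TensorProduct.map (LinearMap.id (R := R) (M := H)) K.subtype))

section Coinvariants

variable {R H : Type*} [CommRing R] [Ring H] [Bialgebra R H] {K : Submodule R H}

theorem mem_coinvariants {y : H} :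
    y ∈ coinvariants K ↔
      Coalgebra.comul (R := R) y - y ⊗ₜ[R] 1 ∈ LinearMap.range (K.subtype.lTensor H) :=
  Iff.rfl

theorem one_mem_coinvariants : (1 : H) ∈ coinvariants K := by
  rw [mem_coinvariants, Bialgebra.comul_one, Algebra.TensorProduct.one_def, sub_self]
  exact zero_mem _

/-- If `K` is a left ideal of `H`, then `H ⊗ K` is a left ideal of `H ⊗ H`. -/
theorem mul_mem_range_lTensor_subtype (hK : ∀ h : H, ∀ x ∈ K, h * x ∈ K) (a : H ⊗[R] H)
    {b : H ⊗[R] H} (hb : b ∈ LinearMap.range (K.subtype.lTensor H)) :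
    a * b ∈ LinearMap.range (K.subtype.lTensor H) := by
  obtain ⟨z, rfl⟩ := hb
  induction z with
  | zero => simp
  | add z w hz hw =>
    rw [map_add, mul_add]
    exact add_mem hz hw
  | tmul h x =>
    induction a with
    | zero => simp
    | add a b ha hb =>
      rw [add_mul]
      exact add_mem ha hb
    | tmul g l => exact ⟨(g * h) ⊗ₜ ⟨l * x, hK l x x.2⟩, by simp⟩

theorem mul_tmul_one_mem_range_lTensor_subtype (y : H) {b : H ⊗[R] H}
    (hb : b ∈ LinearMap.range (K.subtype.lTensor H)) :
    b * y ⊗ₜ[R] 1 ∈ LinearMap.range (K.subtype.lTensor H) := by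
  obtain ⟨z, rfl⟩ := hb
  induction z with
  | zero => simp
  | add z w hz hw =>
    rw [map_add, add_mul]
    exact add_mem hz hw
  | tmul h x => exact ⟨(h * y) ⊗ₜ x, by simp⟩

theorem mul_mem_coinvariants (hK : ∀ h : H, ∀ x ∈ K, h * x ∈ K) {x y : H}
    (hx : x ∈ coinvariants K) (hy : y ∈ coinvariants K) : x * y ∈ coinvariants K := by
  rw [mem_coinvariants] at hx hy ⊢
  have h : Coalgebra.comul (R := R) (x * y) - (x * y) ⊗ₜ[R] 1 =
      Coalgebra.comul (R := R) x * (Coalgebra.comul (R := R) y - y ⊗ₜ[R] 1) +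
        (Coalgebra.comul (R := R) x - x ⊗ₜ[R] 1) * y ⊗ₜ[R] 1 := by
    rw [Bialgebra.comul_mul, mul_sub, sub_mul, Algebra.TensorProduct.tmul_mul_tmul, one_mul]
    abel
  rw [h]
  exact add_mem (mul_mem_range_lTensor_subtype hK _ hy)
    (mul_tmul_one_mem_range_lTensor_subtype y hx)

theorem range_lTensor_subtype_eq_ker_lTensor_mkQ :
    LinearMap.range (K.subtype.lTensor H) = LinearMap.ker (K.mkQ.lTensor H) :=
  (lTensor_exact H (LinearMap.exact_subtype_mkQ K) K.mkQ_surjective).linearMap_ker_eq.symm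

/-- The map `y ↦ Δ(y) - y ⊗ 1` modulo `H ⊗ K`, whose kernel is `H^{co K}`. -/
noncomputable def coinvariantsDefect (K : Submodule R H) : H →ₗ[R] H ⊗[R] (H ⧸ K) :=
  K.mkQ.lTensor H ∘ₗ (Coalgebra.comul (R := R) (A := H) - (TensorProduct.mk R H H).flip 1)

theorem ker_coinvariantsDefect :
    LinearMap.ker (coinvariantsDefect K) = coinvariants K := by
  rw [coinvariantsDefect, LinearMap.ker_comp, ← range_lTensor_subtype_eq_ker_lTensor_mkQ]
  rfl

theorem lTensor_coinvariantsDefect_comul (y : H) :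
    (coinvariantsDefect K).lTensor H (Coalgebra.comul (R := R) y) =
      TensorProduct.assoc R H H (H ⧸ K)
        ((Coalgebra.comul (R := R) (A := H)).rTensor (H ⧸ K) (coinvariantsDefect K y)) := by
  have hassoc (w : (H ⊗[R] H) ⊗[R] H) :
      (K.mkQ.lTensor H).lTensor H (TensorProduct.assoc R H H H w) =
        TensorProduct.assoc R H H (H ⧸ K) (K.mkQ.lTensor (H ⊗[R] H) w) := by
    rw [LinearMap.lTensor_tensor]
    simp
  have hmk (w : H ⊗[R] H) :
      ((TensorProduct.mk R H H).flip 1).lTensor H w =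
        TensorProduct.assoc R H H H (w ⊗ₜ[R] 1) := by
    induction w with
    | zero => simp
    | add z w hz hw => rw [map_add, hz, hw, TensorProduct.add_tmul, map_add]
    | tmul a b => simp
  have hcomm (w : H ⊗[R] H) :
      (Coalgebra.comul (R := R) (A := H)).rTensor (H ⧸ K) (K.mkQ.lTensor H w) =
        K.mkQ.lTensor (H ⊗[R] H) ((Coalgebra.comul (R := R) (A := H)).rTensor H w) := by
    rw [← LinearMap.comp_apply, ← LinearMap.comp_apply, LinearMap.rTensor_comp_lTensor,
      LinearMap.lTensor_comp_rTensor]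
  rw [coinvariantsDefect, LinearMap.comp_apply, hcomm, ← hassoc, LinearMap.lTensor_comp,
    LinearMap.comp_apply, LinearMap.lTensor_sub, LinearMap.sub_apply, LinearMap.sub_apply,
    map_sub ((Coalgebra.comul (R := R) (A := H)).rTensor H), map_sub (TensorProduct.assoc R H H H),
    Coalgebra.coassoc_apply, hmk]
  rfl

theorem comul_mem_range_lTensor_coinvariants [Module.Flat R H] {y : H}
    (hy : y ∈ coinvariants K) :
    Coalgebra.comul (R := R) y ∈ LinearMap.range ((coinvariants K).subtype.lTensor H) := by
  have hexact : Function.Exact (coinvariants K).subtype (coinvariantsDefect K) := by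
    rw [LinearMap.exact_iff, Submodule.range_subtype, ker_coinvariantsDefect]
  rw [← (Module.Flat.lTensor_exact H hexact).linearMap_ker_eq, LinearMap.mem_ker,
    lTensor_coinvariantsDefect_comul]
  rw [← ker_coinvariantsDefect, LinearMap.mem_ker] at hy
  rw [hy, map_zero, map_zero]

end Coinvariants

/-- Let `H` be a bialgebra over a field `k` and `K ⊆ H` a subspace with
`H·K ⊆ K`, `ε(K) = 0` and `Δ(K) ⊆ K⊗H + H⊗K` (a left ideal and coideal).  Then
`H^{co K}` is a unital subalgebra of `H` and a left coideal: `Δ(H^{co K}) ⊆ H ⊗ H^{co K}`. -/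
theorem stmt_6 {k H : Type*} [Field k] [Ring H] [Bialgebra k H]
    (K : Submodule k H)
    (hKl : ∀ h : H, ∀ x ∈ K, h * x ∈ K)
    (hKε : ∀ x ∈ K, Coalgebra.counit (R := k) x = (0 : k))
    (hKΔ : ∀ x ∈ K, Coalgebra.comul (R := k) x ∈
      LinearMap.range (TensorProduct.map K.subtype (LinearMap.id (R := k) (M := H))) ⊔
      LinearMap.range (TensorProduct.map (LinearMap.id (R := k) (M := H)) K.subtype)) :
    (1 : H) ∈ coinvariants K ∧
    (∀ x ∈ coinvariants K, ∀ y ∈ coinvariants K, x * y ∈ coinvariants K) ∧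
    (∀ x ∈ coinvariants K, Coalgebra.comul (R := k) x ∈
      LinearMap.range (TensorProduct.map (LinearMap.id (R := k) (M := H))
        (coinvariants K).subtype)) := by
  exact ⟨one_mem_coinvariants, fun _ hx _ hy => mul_mem_coinvariants hKl hx hy,
    fun _ hx => comul_mem_range_lTensor_coinvariants hx⟩
end

section
/- Let H be a bialgebra over a commutative ring R, and let A ⊆ H be an R-submodule with 1 ∈ A, A·A ⊆ A and Δ(A) ⊆ H ⊗ A (a subalgebra and left coideal). Then A ⊆ H^{co(H·A⁺)}, i.e. for every a ∈ A one has Δ(a) − a⊗1 ∈ H ⊗ (H·A⁺). (This is one of the two Galois-type inclusions relating the maps A ↦ H·A⁺ and K ↦ H^{co K}, used in Subsection 3.6 to show these maps are mutually inverse on quantizations.) -/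
open TensorProduct

/-- A linear map sending `M` into `N` sends the image of `P ⊗ M` into the image of `P ⊗ N`. -/
theorem lTensor_mem_range_map_subtype {R P V W : Type*} [CommRing R] [AddCommGroup P] [Module R P]
    [AddCommGroup V] [Module R V] [AddCommGroup W] [Module R W]
    {M : Submodule R V} {N : Submodule R W} (f : V →ₗ[R] W) (hf : ∀ x ∈ M, f x ∈ N)
    {t : P ⊗[R] V}
    (ht : t ∈ LinearMap.range (TensorProduct.map (LinearMap.id (R := R) (M := P)) M.subtype)) :
    f.lTensor P t ∈
      LinearMap.range (TensorProduct.map (LinearMap.id (R := R) (M := P)) N.subtype) := by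
  obtain ⟨s, rfl⟩ := ht
  refine ⟨(f.restrict hf).lTensor P s, ?_⟩
  induction s with
  | zero => simp
  | tmul x y => simp
  | add x y hx hy => simp only [map_add, hx, hy]

/-- Applying `x ↦ x - ε(x)1` to the second leg of `Δ(a)` gives `Δ(a) - a ⊗ 1`. -/
theorem lTensor_id_sub_counit_comul {R H : Type*} [CommRing R] [Ring H] [Bialgebra R H] (a : H) :
    (LinearMap.id - Algebra.linearMap R H ∘ₗ Coalgebra.counit (R := R) (A := H)).lTensor H
      (Coalgebra.comul (R := R) a) = Coalgebra.comul (R := R) a - a ⊗ₜ[R] (1 : H) := by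
  rw [LinearMap.lTensor_sub, LinearMap.sub_apply, LinearMap.lTensor_id, LinearMap.id_apply,
    LinearMap.lTensor_comp, LinearMap.comp_apply, Coalgebra.lTensor_counit_comul]
  simp

/-- Let `H` be a bialgebra over a commutative ring `R` and `A ⊆ H` a
submodule with `1 ∈ A`, `A·A ⊆ A` and `Δ(A) ⊆ H ⊗ A`.  Then `A ⊆ H^{co(H·A⁺)}`:
for every `a ∈ A`, `Δ(a) − a⊗1 ∈ H ⊗ (H·A⁺)`. -/
theorem stmt_7 {R H : Type*} [CommRing R] [Ring H] [Bialgebra R H]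
    (A : Submodule R H) (h1 : (1 : H) ∈ A)
    (hmul : ∀ x ∈ A, ∀ y ∈ A, x * y ∈ A)
    (hco : ∀ a ∈ A, Coalgebra.comul (R := R) a ∈
      LinearMap.range (TensorProduct.map (LinearMap.id (R := R) (M := H)) A.subtype)) :
    ∀ a ∈ A, Coalgebra.comul (R := R) a - a ⊗ₜ[R] (1 : H) ∈
      LinearMap.range (TensorProduct.map (LinearMap.id (R := R) (M := H))
        (leftIdealSpan R (A ⊓ LinearMap.ker (Coalgebra.counit (R := R) (A := H)))).subtype) := by
  intro a ha
  rw [← lTensor_id_sub_counit_comul]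
  refine lTensor_mem_range_map_subtype _ (fun x hx => ?_) (hco a ha)
  refine Submodule.subset_span ⟨1, _, ⟨?_, ?_⟩, (one_mul _).symm⟩
  · simpa [Algebra.algebraMap_eq_smul_one] using A.sub_mem hx (A.smul_mem _ h1)
  · simp
end

section
/- Let H be a bialgebra over a commutative ring R, and let K ⊆ H be an R-submodule with H·K ⊆ K, ε(K) = 0 and Δ(K) ⊆ K⊗H + H⊗K (a left ideal and coideal). Then (H^{co K})⁺ ⊆ K, and consequently H·(H^{co K})⁺ ⊆ K. (This is the second Galois-type inclusion relating the maps A ↦ H·A⁺ and K ↦ H^{co K}, used in Subsection 3.6 to show these maps are mutually inverse on quantizations.) -/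
open TensorProduct

/-- Let `H` be a bialgebra over a commutative ring `R` and `K ⊆ H` a
submodule with `H·K ⊆ K`, `ε(K) = 0` and `Δ(K) ⊆ K⊗H + H⊗K`.  Then `(H^{co K})⁺ ⊆ K`
and consequently `H·(H^{co K})⁺ ⊆ K`. -/
theorem stmt_8 {R H : Type*} [CommRing R] [Ring H] [Bialgebra R H]
    (K : Submodule R H)
    (hKl : ∀ h : H, ∀ x ∈ K, h * x ∈ K)
    (hKε : ∀ x ∈ K, Coalgebra.counit (R := R) x = (0 : R))
    (hKΔ : ∀ x ∈ K, Coalgebra.comul (R := R) x ∈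
      LinearMap.range (TensorProduct.map K.subtype (LinearMap.id (R := R) (M := H))) ⊔
      LinearMap.range (TensorProduct.map (LinearMap.id (R := R) (M := H)) K.subtype)) :
    (coinvariants K ⊓ LinearMap.ker (Coalgebra.counit (R := R) (A := H)) ≤ K) ∧
    (leftIdealSpan R (coinvariants K ⊓ LinearMap.ker (Coalgebra.counit (R := R) (A := H)))
      ≤ K) := by
  have h : coinvariants K ⊓ LinearMap.ker (Coalgebra.counit (R := R) (A := H)) ≤ K := by
    rintro y ⟨⟨t, ht⟩, hy⟩
    have hy' : Coalgebra.counit (R := R) y = 0 := hy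
    have ht_mem : TensorProduct.lid R H (Coalgebra.counit.rTensor H
        (TensorProduct.map (LinearMap.id (R := R) (M := H)) K.subtype t)) ∈ K := by
      clear ht
      induction t with
      | zero => simp
      | tmul a b => simpa using K.smul_mem _ b.2
      | add a b ha hb => simpa using K.add_mem ha hb
    rw [ht] at ht_mem
    simpa [hy'] using ht_mem
  refine ⟨h, Submodule.span_le.2 ?_⟩
  rintro x ⟨a, m, hm, rfl⟩
  exact hKl a m (h hm)
end
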